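/- Let X_1,...,X_n be indicator random variables and 0 < α < β < 1. If for every subset S of {1,...,n} of size k = ⌈((β-α)/(1-α))·n⌉ we have P(∀ i ∈ S, X_i = 1) ≤ α^k, then P(X_1+...+X_n ≥ βn) ≤ exp(-D(β‖α)·n), where D(β‖α) = β·ln(β/α) + (1-β)·ln((1-β)/(1-α)). -/

import Mathlib

open MeasureTheory Finset
open scoped ENNReal

lemma mul_log_one_add_div_le {d q v : ℝ} (hd : 0 ≤ d) (hq : 0 < q) (hqv : q ≤ v) :
    q * Real.log (1 + d / q) ≤ v * Real.log (1 + d / v) := by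
  have hv : 0 < v := hq.trans_le hqv
  have hdv : 0 ≤ d / v := by positivity
  have bernoulli := one_add_mul_self_le_rpow_one_add (s := d / v) (by linarith)
    ((one_le_div hq).2 hqv)
  have hdq : v / q * (d / v) = d / q := by field_simp
  rw [hdq] at bernoulli
  have hlog := Real.log_le_log (by positivity) bernoulli
  rw [Real.log_rpow (by positivity)] at hlog
  calc q * Real.log (1 + d / q) ≤ q * (v / q * Real.log (1 + d / v)) := by gcongr
    _ = v * Real.log (1 + d / v) := by field_simp

/-- An antiderivative of `t ↦ log (α * (N - t) / (M - t))`. -/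
noncomputable def logRatioPrimitive (α N M t : ℝ) : ℝ :=
  t * Real.log α - (N - t) * Real.log (N - t) + (M - t) * Real.log (M - t)

lemma mul_log_ratio_le_primitive_sub {α N M a b : ℝ} (hα : 0 < α) (hab : a ≤ b)
    (hbM : b < M) (hMN : M ≤ N) :
    (b - a) * Real.log (α * (N - a) / (M - a)) ≤
      logRatioPrimitive α N M b - logRatioPrimitive α N M a := by
  have hq : 0 < M - b := by linarith
  have hv : 0 < N - b := by linarith
  have hp : 0 < M - a := by linarith
  have hu : 0 < N - a := by linarith
  have key := mul_log_one_add_div_le (sub_nonneg.2 hab) hq (by linarith : M - b ≤ N - b)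
  have h1 : 1 + (b - a) / (M - b) = (M - a) / (M - b) := by field_simp; ring
  have h2 : 1 + (b - a) / (N - b) = (N - a) / (N - b) := by field_simp; ring
  rw [h1, h2, Real.log_div hp.ne' hq.ne', Real.log_div hu.ne' hv.ne'] at key
  rw [Real.log_div (by positivity) hp.ne', Real.log_mul hα.ne' hu.ne']
  unfold logRatioPrimitive
  linarith

lemma sum_log_ratio_le_primitive_sub {α N M x : ℝ} (hα : 0 < α) (hx : 0 ≤ x) (hxM : x < M)
    (hMN : M ≤ N) (hxα : α * N - M ≤ (α - 1) * x) (hα1 : α < 1) :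
    ∑ i ∈ range ⌈x⌉₊, Real.log (α * (N - i) / (M - i)) ≤
      logRatioPrimitive α N M x - logRatioPrimitive α N M 0 := by
  have step : ∀ i ∈ range ⌈x⌉₊, Real.log (α * (N - i) / (M - i)) ≤
      logRatioPrimitive α N M (min ((i + 1 : ℕ) : ℝ) x) -
        logRatioPrimitive α N M (min (i : ℝ) x) := by
    intro i hi
    have hix : (i : ℝ) < x := Nat.lt_ceil.1 (mem_range.1 hi)
    rw [min_eq_left hix.le]
    have hle : (i : ℝ) ≤ min ((i + 1 : ℕ) : ℝ) x := le_min (by push_cast; linarith) hix.le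
    refine le_trans ?_ (mul_log_ratio_le_primitive_sub hα hle
      ((min_le_right _ _).trans_lt hxM) hMN)
    have hlen : min ((i + 1 : ℕ) : ℝ) x - i ≤ 1 := by
      have := min_le_left ((i + 1 : ℕ) : ℝ) x
      push_cast at this ⊢
      linarith
    have hM : 0 < M - i := by linarith
    have hN : 0 < N - i := by linarith
    have hneg : Real.log (α * (N - i) / (M - i)) ≤ 0 := by
      refine Real.log_nonpos (by positivity) ((div_le_one hM).2 ?_)
      nlinarith
    nlinarith
  refine (sum_le_sum step).trans_eq ?_
  rw [sum_range_sub (fun i : ℕ => logRatioPrimitive α N M (min (i : ℝ) x)),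
    min_eq_right (Nat.le_ceil x), Nat.cast_zero, min_eq_left hx]

lemma logRatioPrimitive_sub_eq_neg_klDiv {α β N : ℝ} (hα : 0 < α) (hαβ : α < β) (hβ : β < 1)
    (hN : 0 < N) :
    logRatioPrimitive α N (β * N) ((β - α) / (1 - α) * N) - logRatioPrimitive α N (β * N) 0 =
      -(β * Real.log (β / α) + (1 - β) * Real.log ((1 - β) / (1 - α))) * N := by
  have hα1 : 0 < 1 - α := by linarith
  have hβ1 : 0 < 1 - β := by linarith
  have hβ0 : 0 < β := by linarith
  have h1 : N - (β - α) / (1 - α) * N = (1 - β) / (1 - α) * N := by field_simp; ring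
  have h2 : β * N - (β - α) / (1 - α) * N = α * ((1 - β) / (1 - α) * N) := by
    field_simp; ring
  unfold logRatioPrimitive
  rw [h1, h2, sub_zero, sub_zero, Real.log_mul hα.ne' (by positivity),
    Real.log_mul (by positivity) hN.ne', Real.log_mul hβ0.ne' hN.ne',
    Real.log_div hβ1.ne' hα1.ne', Real.log_div hβ0.ne' hα.ne']
  field_simp
  ring

lemma cast_descFactorial_eq_prod {n k : ℕ} (hkn : k ≤ n) :
    (n.descFactorial k : ℝ) = ∏ i ∈ range k, ((n : ℝ) - i) := by
  rw [Nat.descFactorial_eq_prod_range, Nat.cast_prod]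
  refine prod_congr rfl fun i hi => ?_
  rw [Nat.cast_sub ((mem_range.1 hi).le.trans hkn)]

lemma choose_mul_pow_le_exp_mul_choose {α β : ℝ} (hα : 0 < α) (hαβ : α < β) (hβ : β < 1)
    {n m : ℕ} (hn : 0 < n) (hm : β * n ≤ m) :
    (n.choose ⌈(β - α) / (1 - α) * (n : ℝ)⌉₊ : ℝ) * α ^ ⌈(β - α) / (1 - α) * (n : ℝ)⌉₊ ≤
      Real.exp (-(β * Real.log (β / α) + (1 - β) * Real.log ((1 - β) / (1 - α))) * n) *
        (m.choose ⌈(β - α) / (1 - α) * (n : ℝ)⌉₊ : ℝ) := by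
  have hN : (0 : ℝ) < n := by exact_mod_cast hn
  have hα1 : 0 < 1 - α := by linarith
  set x : ℝ := (β - α) / (1 - α) * n with hx
  have hx0 : 0 ≤ x := by
    have : 0 < β - α := by linarith
    positivity
  have hxM : x < β * n := by
    refine mul_lt_mul_of_pos_right ((div_lt_iff₀ hα1).2 ?_) hN
    nlinarith
  have hMN : β * n ≤ (n : ℝ) := by nlinarith
  have hxα : α * n - β * n ≤ (α - 1) * x := by
    apply le_of_eq
    rw [hx]
    field_simp
    ring
  have hkn : ⌈x⌉₊ ≤ n := Nat.ceil_le.2 (by linarith)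
  have hkm : ⌈x⌉₊ ≤ m := Nat.ceil_le.2 (by linarith)
  have hsum := sum_log_ratio_le_primitive_sub hα hx0 hxM hMN hxα (by linarith)
  rw [hx, logRatioPrimitive_sub_eq_neg_klDiv hα hαβ hβ hN, ← hx] at hsum
  have hprod : ∏ i ∈ range ⌈x⌉₊, (α * ((n : ℝ) - i)) ≤
      Real.exp (-(β * Real.log (β / α) + (1 - β) * Real.log ((1 - β) / (1 - α))) * n) *
        ∏ i ∈ range ⌈x⌉₊, ((m : ℝ) - i) := by
    have hlt : ∀ i ∈ range ⌈x⌉₊, (i : ℝ) < x := fun i hi => Nat.lt_ceil.1 (mem_range.1 hi)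
    calc ∏ i ∈ range ⌈x⌉₊, (α * ((n : ℝ) - i))
        ≤ ∏ i ∈ range ⌈x⌉₊,
            (Real.exp (Real.log (α * ((n : ℝ) - i) / (β * n - i))) * ((m : ℝ) - i)) := by
          refine prod_le_prod (fun i hi => ?_) fun i hi => ?_
          · have := hlt i hi
            exact mul_nonneg hα.le (by linarith)
          · have := hlt i hi
            have hM : 0 < β * n - i := by linarith
            have hNi : 0 < (n : ℝ) - i := by linarith
            rw [Real.exp_log (by positivity)]
            calc α * ((n : ℝ) - i) = α * ((n : ℝ) - i) / (β * n - i) * (β * n - i) :=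
                  (div_mul_cancel₀ _ hM.ne').symm
              _ ≤ _ := by gcongr
      _ ≤ _ := by
          rw [prod_mul_distrib, ← Real.exp_sum]
          refine mul_le_mul_of_nonneg_right (Real.exp_le_exp.2 hsum) (prod_nonneg fun i hi => ?_)
          have := hlt i hi
          linarith
  rw [prod_mul_distrib, prod_const, card_range, ← cast_descFactorial_eq_prod hkn,
    ← cast_descFactorial_eq_prod hkm, Nat.descFactorial_eq_factorial_mul_choose,
    Nat.descFactorial_eq_factorial_mul_choose] at hprod
  push_cast at hprod
  have hfact : (0 : ℝ) < (⌈x⌉₊.factorial : ℝ) := by exact_mod_cast Nat.factorial_pos _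
  refine le_of_mul_le_mul_left ?_ hfact
  linarith

lemma sum_indicators_eq_card {ι : Type*} [Fintype ι] {f : ι → ℝ}
    [DecidablePred fun i => f i = 1] (hf : ∀ i, f i = 0 ∨ f i = 1) :
    ∑ i, f i = ((univ.filter fun i => f i = 1).card : ℝ) := by
  rw [card_filter, Nat.cast_sum]
  refine sum_congr rfl fun i _ => ?_
  rcases hf i with h | h <;> simp [h]

/-- Markov's inequality for the number of `k`-subsets of events occurring simultaneously. -/
lemma choose_mul_measure_card_ge_le {Ω ι : Type*} [MeasurableSpace Ω] [Fintype ι]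
    (μ : Measure Ω) {X : ι → Ω → ℝ} (hX : ∀ i, Measurable (X i))
    (hind : ∀ i ω, X i ω = 0 ∨ X i ω = 1) (k m : ℕ) :
    (m.choose k : ℝ≥0∞) * μ {ω | (m : ℝ) ≤ ∑ i, X i ω} ≤
      ∑ S ∈ (univ : Finset ι).powersetCard k, μ {ω | ∀ i ∈ S, X i ω = 1} := by
  classical
  have hmeas : ∀ S : Finset ι, MeasurableSet {ω | ∀ i ∈ S, X i ω = 1} := by
    intro S
    simp only [Set.ofPred_forall]
    exact S.measurableSet_biInter fun i _ => hX i (measurableSet_singleton 1)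
  have hF : Measurable fun ω => ∑ S ∈ (univ : Finset ι).powersetCard k,
      {ω | ∀ i ∈ S, X i ω = 1}.indicator (1 : Ω → ℝ≥0∞) ω :=
    Finset.measurable_fun_sum _ fun S _ => measurable_one.indicator (hmeas S)
  have hlintegral : ∫⁻ ω, ∑ S ∈ (univ : Finset ι).powersetCard k,
      {ω | ∀ i ∈ S, X i ω = 1}.indicator (1 : Ω → ℝ≥0∞) ω ∂μ =
      ∑ S ∈ (univ : Finset ι).powersetCard k, μ {ω | ∀ i ∈ S, X i ω = 1} := by
    rw [lintegral_finsetSum _ fun S _ => measurable_one.indicator (hmeas S)]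
    exact sum_congr rfl fun S _ => lintegral_indicator_one (hmeas S)
  rw [← hlintegral]
  refine le_trans ?_ (mul_meas_ge_le_lintegral hF (m.choose k : ℝ≥0∞))
  gcongr with ω
  intro hω
  rw [sum_indicators_eq_card fun i => hind i ω, Nat.cast_le] at hω
  set T : Finset ι := univ.filter fun i => X i ω = 1
  calc (m.choose k : ℝ≥0∞) ≤ ((T.powersetCard k).card : ℝ≥0∞) := by
        rw [card_powersetCard]
        exact_mod_cast Nat.choose_le_choose k hω
    _ = ∑ S ∈ T.powersetCard k, {ω | ∀ i ∈ S, X i ω = 1}.indicator (1 : Ω → ℝ≥0∞) ω := by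
        rw [card_eq_sum_ones, Nat.cast_sum]
        refine sum_congr rfl fun S hS => ?_
        have hω' : ω ∈ {ω | ∀ i ∈ S, X i ω = 1} := fun i hi =>
          (mem_filter.1 ((mem_powersetCard.1 hS).1 hi)).2
        rw [Set.indicator_of_mem hω']
        simp
    _ ≤ _ := sum_le_sum_of_subset (powersetCard_mono (subset_univ T))

/-- Linial–Luria generalized Chernoff bound, second part. -/
theorem linial_luria_second_part {Ω : Type*} [MeasurableSpace Ω]
    (μ : Measure Ω) [IsProbabilityMeasure μ]
    (n : ℕ) (X : Fin n → Ω → ℝ) (hX : ∀ i, Measurable (X i))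
    (hind : ∀ i ω, X i ω = 0 ∨ X i ω = 1)
    (α β : ℝ) (hα0 : 0 < α) (hαβ : α < β) (hβ1 : β < 1)
    (k : ℕ) (hk : k = ⌈((β - α) / (1 - α)) * (n : ℝ)⌉₊)
    (hS : ∀ S ∈ (Finset.univ : Finset (Fin n)).powersetCard k,
      μ {ω | ∀ i ∈ S, X i ω = 1} ≤ ENNReal.ofReal (α ^ k)) :
    μ {ω | β * n ≤ ∑ i, X i ω} ≤
      ENNReal.ofReal (Real.exp
        (-(β * Real.log (β / α) + (1 - β) * Real.log ((1 - β) / (1 - α))) * n)) := by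
  rcases Nat.eq_zero_or_pos n with rfl | hn
  · simp
  set m : ℕ := ⌈β * n⌉₊ with hm
  have hN : (0 : ℝ) < n := by exact_mod_cast hn
  have hkm : k ≤ m := by
    rw [hk, hm]
    refine Nat.ceil_mono (mul_le_mul_of_nonneg_right ?_ hN.le)
    rw [div_le_iff₀ (by linarith)]
    nlinarith
  have hsub : {ω | β * n ≤ ∑ i, X i ω} ⊆ {ω | (m : ℝ) ≤ ∑ i, X i ω} := by
    intro ω hω
    rw [Set.mem_ofPred_eq, sum_indicators_eq_card fun i => hind i ω] at hω ⊢
    exact_mod_cast Nat.ceil_le.2 hω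
  have hreal := choose_mul_pow_le_exp_mul_choose hα0 hαβ hβ1 hn (Nat.le_ceil (β * n))
  rw [← hk, ← hm] at hreal
  set E := Real.exp (-(β * Real.log (β / α) + (1 - β) * Real.log ((1 - β) / (1 - α))) * n)
  have hchoose : (m.choose k : ℝ≥0∞) ≠ 0 := by exact_mod_cast (Nat.choose_pos hkm).ne'
  refine (measure_mono hsub).trans ?_
  rw [← ENNReal.mul_le_mul_iff_right hchoose (ENNReal.natCast_ne_top _)]
  calc (m.choose k : ℝ≥0∞) * μ {ω | (m : ℝ) ≤ ∑ i, X i ω}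
      ≤ ∑ S ∈ (univ : Finset (Fin n)).powersetCard k, μ {ω | ∀ i ∈ S, X i ω = 1} :=
        choose_mul_measure_card_ge_le μ hX hind k m
    _ ≤ ∑ _S ∈ (univ : Finset (Fin n)).powersetCard k, ENNReal.ofReal (α ^ k) := sum_le_sum hS
    _ = ENNReal.ofReal (n.choose k * α ^ k) := by
        rw [sum_const, card_powersetCard, card_univ, Fintype.card_fin, nsmul_eq_mul,
          ENNReal.ofReal_mul (by positivity), ENNReal.ofReal_natCast]
    _ ≤ ENNReal.ofReal (E * m.choose k) := ENNReal.ofReal_le_ofReal hreal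
    _ = (m.choose k : ℝ≥0∞) * ENNReal.ofReal E := by
        rw [mul_comm, ENNReal.ofReal_mul (by positivity), ENNReal.ofReal_natCast]
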